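/- Let n ≥ 2 and let p_1, …, p_n be points in the Euclidean plane, and define A'(i,j) as the minimum bottleneck of an (i,j)-partial tour. The minimum bottleneck of a pyramidal tour of p_1, …, p_n equals the minimum over 1 ≤ k < n of max( A'(n, k), dist(p_k, p_n) ). -/

import Mathlib

noncomputable section

/-- Points in the Euclidean plane. -/
abbrev Pt := EuclideanSpace ℝ (Fin 2)

/-- The pairs `(x, x')` of elements of `X` with `x < x'` that are consecutive in `X`,
i.e. no element of `X` lies strictly between them. -/
def consecPairs (X : Finset ℕ) : Finset (ℕ × ℕ) :=
  (X ×ˢ X).filter fun q => q.1 < q.2 ∧ ∀ y ∈ X, ¬ (q.1 < y ∧ y < q.2)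

/-- The chain bottleneck of `X`: the maximum distance between consecutive elements of `X`
(`0` if `X` has at most one element). -/
def chainBot (p : ℕ → Pt) (X : Finset ℕ) : ℝ :=
  (consecPairs X).fold max 0 fun q => dist (p q.1) (p q.2)

/-- `(S, T)` is an `(i,j)`-partial tour: `S ∪ T = {1,…,i}`, `S ∩ T = {1}`,
`max S = i` and `max T = j`. -/
def IsPartialTour (i j : ℕ) (S T : Finset ℕ) : Prop :=
  S ∪ T = Finset.Icc 1 i ∧ S ∩ T = {1} ∧ S.max = (i : WithBot ℕ) ∧ T.max = (j : WithBot ℕ)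

/-- `A' i j`: the minimum bottleneck of an `(i,j)`-partial tour. -/
def tourA' (p : ℕ → Pt) (i j : ℕ) : ℝ :=
  sInf {L : ℝ | ∃ S T : Finset ℕ,
    IsPartialTour i j S T ∧ L = max (chainBot p S) (chainBot p T)}

/-- `(S, T)` is a pyramidal tour of `p₁,…,pₙ`: `S ∪ T = {1,…,n}` and `S ∩ T = {1, n}`. -/
def IsPyramidal (n : ℕ) (S T : Finset ℕ) : Prop :=
  S ∪ T = Finset.Icc 1 n ∧ S ∩ T = {1, n}

lemma chainBot_le_iff (p : ℕ → Pt) (X : Finset ℕ) (c : ℝ) :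
    chainBot p X ≤ c ↔ 0 ≤ c ∧ ∀ q ∈ consecPairs X, dist (p q.1) (p q.2) ≤ c := by
  unfold chainBot
  exact Finset.fold_max_le c

lemma chainBot_nonneg (p : ℕ → Pt) (X : Finset ℕ) : 0 ≤ chainBot p X :=
  ((chainBot_le_iff p X _).1 le_rfl).1

lemma consecPairs_insert (T : Finset ℕ) (k n : ℕ) (hk : k ∈ T) (hmax : ∀ y ∈ T, y ≤ k)
    (hkn : k < n) : consecPairs (insert n T) = insert (k, n) (consecPairs T) := by
  ext ⟨a, b⟩
  simp only [consecPairs, Finset.mem_filter, Finset.mem_product, Finset.mem_insert,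
    Prod.mk.injEq]
  constructor
  · rintro ⟨⟨ha, hb⟩, hab, h⟩
    rcases hb with rfl | hb
    · left
      rcases ha with rfl | ha
      · omega
      · have h1 := h k (Or.inr hk)
        have h2 := hmax a ha
        omega
    · right
      rcases ha with rfl | ha
      · have := hmax b hb
        omega
      · exact ⟨⟨ha, hb⟩, hab, fun y hy => h y (Or.inr hy)⟩
  · rintro (⟨rfl, rfl⟩ | ⟨⟨ha, hb⟩, hab, h⟩)
    · refine ⟨⟨Or.inr hk, Or.inl rfl⟩, hkn, ?_⟩
      rintro y (rfl | hy)
      · omega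
      · have := hmax y hy
        omega
    · refine ⟨⟨Or.inr ha, Or.inr hb⟩, hab, ?_⟩
      rintro y (rfl | hy)
      · have := hmax b hb
        omega
      · exact h y hy

lemma chainBot_insert (p : ℕ → Pt) (T : Finset ℕ) (k n : ℕ) (hk : k ∈ T)
    (hmax : ∀ y ∈ T, y ≤ k) (hkn : k < n) :
    chainBot p (insert n T) = max (dist (p k) (p n)) (chainBot p T) := by
  unfold chainBot
  rw [consecPairs_insert T k n hk hmax hkn, Finset.fold_insert_idem]

lemma max_iff (T : Finset ℕ) (k : ℕ) :
    T.max = (k : WithBot ℕ) ↔ k ∈ T ∧ ∀ y ∈ T, y ≤ k := by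
  constructor
  · intro h
    exact ⟨Finset.mem_of_max h, fun y hy => Finset.le_max_of_eq hy h⟩
  · rintro ⟨h, h'⟩
    apply le_antisymm
    · exact Finset.max_le fun y hy => WithBot.coe_le_coe.2 (h' y hy)
    · exact Finset.le_max h

lemma bdd_max (p : ℕ → Pt) (P : Finset ℕ → Finset ℕ → Prop) :
    BddBelow {L : ℝ | ∃ S T : Finset ℕ, P S T ∧ L = max (chainBot p S) (chainBot p T)} := by
  refine ⟨0, ?_⟩
  rintro _ ⟨S, T, -, rfl⟩
  exact le_max_of_le_left (chainBot_nonneg p S)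

lemma exists_partial (n k : ℕ) (h1 : 1 ≤ k) (hk : k < n) : ∃ S T, IsPartialTour n k S T := by
  refine ⟨(Finset.Icc 1 n).filter (fun x => x = 1 ∨ x ≠ k), {1, k}, ?_, ?_, ?_, ?_⟩
  · ext x
    simp only [Finset.mem_union, Finset.mem_filter, Finset.mem_Icc, Finset.mem_insert,
      Finset.mem_singleton]
    omega
  · ext x
    simp only [Finset.mem_inter, Finset.mem_filter, Finset.mem_Icc, Finset.mem_insert,
      Finset.mem_singleton]
    omega
  · rw [max_iff]
    simp only [Finset.mem_filter, Finset.mem_Icc]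
    exact ⟨by omega, fun y hy => by omega⟩
  · rw [max_iff]
    simp only [Finset.mem_insert, Finset.mem_singleton]
    exact ⟨by simp, fun y hy => by omega⟩

lemma partial_to_pyr (n k : ℕ) (S T : Finset ℕ) (h : IsPartialTour n k S T) :
    IsPyramidal n S (insert n T) := by
  obtain ⟨h1, h2, h3, -⟩ := h
  have hn := ((max_iff _ _).1 h3).1
  constructor
  · rw [Finset.union_insert, h1, Finset.insert_eq_self, ← h1]
    exact Finset.mem_union_left _ hn
  · rw [Finset.inter_insert_of_mem hn, h2, Finset.pair_comm]

lemma pyr_to_partial (n : ℕ) (hn : 2 ≤ n) (S T : Finset ℕ) (h : IsPyramidal n S T) :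
    ∃ k T', 1 ≤ k ∧ k < n ∧ T = insert n T' ∧ IsPartialTour n k S T' := by
  obtain ⟨h1, h2⟩ := h
  have hU : ∀ x, (x ∈ S ∨ x ∈ T) ↔ (1 ≤ x ∧ x ≤ n) := fun x => by
    rw [← Finset.mem_union, h1, Finset.mem_Icc]
  have hI : ∀ x, (x ∈ S ∧ x ∈ T) ↔ (x = 1 ∨ x = n) := fun x => by
    rw [← Finset.mem_inter, h2, Finset.mem_insert, Finset.mem_singleton]
  have hnS := (hI n).2 (Or.inr rfl)
  have h1S := (hI 1).2 (Or.inl rfl)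
  have h1T : 1 ∈ T.erase n := Finset.mem_erase.2 ⟨by omega, h1S.2⟩
  obtain ⟨k, hk⟩ := Finset.max_of_mem h1T
  have hk' := (max_iff _ _).1 hk
  have hkT := Finset.mem_erase.1 hk'.1
  have hb := (hU k).1 (Or.inr hkT.2)
  refine ⟨k, T.erase n, hb.1, by omega, (Finset.insert_erase hnS.2).symm, ?_, ?_, ?_, hk⟩
  · ext x
    rw [Finset.mem_union, Finset.mem_erase, Finset.mem_Icc, ← hU]
    by_cases hx : x = n
    · subst hx; tauto
    · tauto
  · ext x
    rw [Finset.mem_inter, Finset.mem_erase, Finset.mem_singleton]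
    have := hI x
    constructor
    · tauto
    · rintro rfl
      exact ⟨h1S.1, by omega, h1S.2⟩
  · rw [max_iff]
    exact ⟨hnS.1, fun y hy => ((hU y).1 (Or.inl hy)).2⟩

theorem stmt_5 (n : ℕ) (hn : 2 ≤ n) (p : ℕ → Pt) :
    sInf {L : ℝ | ∃ S T : Finset ℕ,
        IsPyramidal n S T ∧ L = max (chainBot p S) (chainBot p T)} =
      sInf {x : ℝ | ∃ k, 1 ≤ k ∧ k < n ∧
        x = max (tourA' p n k) (dist (p k) (p n))} := by
  apply le_antisymm
  · refine le_csInf ⟨_, 1, le_rfl, by omega, rfl⟩ ?_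
    rintro _ ⟨k, h1, hk, rfl⟩
    rw [le_max_iff]
    by_contra! hcon
    obtain ⟨hA, hd⟩ := hcon
    refine absurd hA (not_lt.2 ?_)
    obtain ⟨S₀, T₀, h₀⟩ := exists_partial n k h1 hk
    refine le_csInf ⟨_, S₀, T₀, h₀, rfl⟩ ?_
    rintro _ ⟨S, T, h, rfl⟩
    have hle := csInf_le (bdd_max p (IsPyramidal n))
      ⟨S, insert n T, partial_to_pyr n k S T h, rfl⟩
    have hm := (max_iff _ _).1 h.2.2.2
    rw [chainBot_insert p T k n hm.1 hm.2 hk, max_left_comm, le_max_iff] at hle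
    exact hle.resolve_left (not_le.2 hd)
  · obtain ⟨S₀, T₀, h₀⟩ := exists_partial n 1 le_rfl (by omega)
    refine le_csInf ⟨_, S₀, _, partial_to_pyr n 1 S₀ T₀ h₀, rfl⟩ ?_
    rintro _ ⟨S, T, h, rfl⟩
    obtain ⟨k, T', h1, hk, rfl, h'⟩ := pyr_to_partial n hn S T h
    have hbdd : BddBelow {x : ℝ | ∃ k, 1 ≤ k ∧ k < n ∧
        x = max (tourA' p n k) (dist (p k) (p n))} := by
      refine ⟨0, ?_⟩
      rintro _ ⟨k, -, -, rfl⟩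
      exact le_max_of_le_right dist_nonneg
    refine (csInf_le hbdd ⟨k, h1, hk, rfl⟩).trans ?_
    have hm := (max_iff _ _).1 h'.2.2.2
    rw [chainBot_insert p T' k n hm.1 hm.2 hk, max_left_comm, max_comm]
    exact max_le_max le_rfl (csInf_le (bdd_max p (IsPartialTour n k)) ⟨S, T', h', rfl⟩)
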